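/- arXiv:1912.07302 — 2 statements merged into one kernel-verified Lean document; each statement's English description precedes it below -/
import Mathlib

section
/- For every positive integer r and every field F, M(F, AD_r) = Z(AD_r) = 2r. Moreover, the adjacency matrix A(AD_r), with entries interpreted in F, has rank |AD_r| − 2r = 2r(r+1) − 2r over every field F; thus AD_r has field independent minimum rank and A(AD_r) is a universally optimal matrix. -/
open scoped Classical

noncomputable section

namespace Paper

variable {V : Type*}

/-- The set of vertices eventually colored blue starting from `Z` under the
zero forcing color change rule. -/
inductive Forced (G : SimpleGraph V) (Z : Set V) : V → Prop
  | init (v : V) : v ∈ Z → Forced G Z v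
  | force (u w : V) : Forced G Z u → G.Adj u w →
      (∀ x, G.Adj u x → x ≠ w → Forced G Z x) → Forced G Z w

/-- `Z` is a zero forcing set of `G`. -/
def IsZeroForcingSet (G : SimpleGraph V) (Z : Set V) : Prop := ∀ v, Forced G Z v

/-- The zero forcing number `Z(G)`. -/
def zfn (G : SimpleGraph V) : ℕ :=
  sInf {m | ∃ Z : Set V, Z.ncard = m ∧ IsZeroForcingSet G Z}

/-- Membership in the set `S(F,G)` of symmetric matrices described by `G`. -/
def SMat (F : Type*) [Field F] (G : SimpleGraph V) (A : Matrix V V F) : Prop :=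
  A.IsSymm ∧ ∀ i j : V, i ≠ j → (A i j ≠ 0 ↔ G.Adj i j)

/-- Maximum nullity `M(F,G)`. -/
def maxNullity (F : Type*) [Field F] [Fintype V] (G : SimpleGraph V) : ℕ :=
  sSup {m | ∃ A : Matrix V V F, SMat F G A ∧ Fintype.card V - A.rank = m}

/-- Minimum rank `mr(F,G)`. -/
def minRank (F : Type*) [Field F] [Fintype V] (G : SimpleGraph V) : ℕ :=
  sInf {m | ∃ A : Matrix V V F, SMat F G A ∧ A.rank = m}

/-- The Strong Arnold Property. -/
def HasSAP [Fintype V] [DecidableEq V] (A : Matrix V V ℝ) : Prop :=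
  ∀ X : Matrix V V ℝ, X.IsSymm → A * X = 0 → Matrix.hadamard A X = 0 →
    Matrix.hadamard (1 : Matrix V V ℝ) X = 0 → X = 0

/-- The Colin de Verdière type parameter `ξ(G)`. -/
def xi [Fintype V] [DecidableEq V] (G : SimpleGraph V) : ℕ :=
  sSup {m | ∃ A : Matrix V V ℝ, SMat ℝ G A ∧ HasSAP A ∧ Fintype.card V - A.rank = m}

/-- The adjacency matrix of `G` with entries in `R`. -/
def adjMat (R : Type*) [Zero R] [One R] (G : SimpleGraph V) : Matrix V V R :=
  Matrix.of fun i j => if G.Adj i j then 1 else 0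

/-- Minimum degree `δ(G)`. -/
def minDeg (G : SimpleGraph V) : ℕ :=
  sInf {d | ∃ v : V, (G.neighborSet v).ncard = d}

/-- Vertex connectivity `κ(G)`. -/
def vertexConnectivity [Fintype V] (G : SimpleGraph V) : ℕ :=
  if G = (⊤ : SimpleGraph V) then Fintype.card V - 1
  else sInf {m | ∃ S : Set V, S.ncard = m ∧ ¬ (G.induce Sᶜ).Connected}

/-- The circulant graph `Circ[n,S]`. -/
def circG (n : ℕ) (S : Set ℕ) : SimpleGraph (ZMod n) :=
  SimpleGraph.fromRel (fun i j => ∃ s ∈ S, j = i + (s : ZMod n))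


/-- The defining predicate for the vertex set of the Aztec diamond graph. -/
def AztecPred (r : ℕ) (p : ℤ × ℤ) : Prop :=
  1 ≤ p.1 ∧ p.1 ≤ 2 * (r : ℤ) ∧ 1 ≤ p.2 ∧ p.2 ≤ 2 * (r : ℤ) ∧
    (r : ℤ) + 1 ≤ p.1 + p.2 ∧ p.1 + p.2 ≤ 3 * (r : ℤ) + 1 ∧ |p.2 - p.1| ≤ (r : ℤ)

/-- The Aztec diamond graph `AD_r`. -/
def aztec (r : ℕ) : SimpleGraph {p : ℤ × ℤ // AztecPred r p} :=
  SimpleGraph.fromRel (fun a b => |a.1.1 - b.1.1| + |a.1.2 - b.1.2| = 1)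

instance aztecFintype (r : ℕ) : Fintype {p : ℤ × ℤ // AztecPred r p} := by
  apply Set.Finite.fintype (s := {p : ℤ × ℤ | AztecPred r p})
  apply Set.Finite.subset (Set.finite_Icc ((1 : ℤ), (1 : ℤ)) ((2 * r : ℤ), (2 * r : ℤ)))
  rintro ⟨x, y⟩ h
  obtain ⟨h1, h2, h3, h4, -⟩ := h
  exact ⟨⟨h1, h3⟩, ⟨h2, h4⟩⟩

/-- If a zero forcing set `Z` carries only zero entries of a null vector, the vector vanishes. -/
theorem Forced.eq_zero {F : Type*} [Field F] [Fintype V] {G : SimpleGraph V} {A : Matrix V V F}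
    (hA : SMat F G A) {Z : Set V} {x : V → F} (hx : A.mulVec x = 0) (hZ : ∀ z ∈ Z, x z = 0)
    {v : V} (hv : Forced G Z v) : x v = 0 := by
  induction hv with
  | init v hv => exact hZ v hv
  | force u w _ huw _ hu hne =>
    have h := congrFun hx u
    rw [Matrix.mulVec, dotProduct, Finset.sum_eq_single w] at h
    · exact (mul_eq_zero.1 h).resolve_left ((hA.2 u w huw.ne).2 huw)
    · intro y _ hyw
      by_cases hy : G.Adj u y
      · rw [hne y hy hyw, mul_zero]
      · by_cases huy : u = y
        · rw [← huy, hu, mul_zero]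
        · rw [not_not.1 (mt (hA.2 u y huy).1 hy), zero_mul]
    · simp

/-- The nullity of a matrix described by `G` is at most the size of any zero forcing set. -/
theorem IsZeroForcingSet.card_le_rank_add_ncard {F : Type*} [Field F] [Fintype V]
    {G : SimpleGraph V} {A : Matrix V V F} (hA : SMat F G A) {Z : Set V}
    (hZ : IsZeroForcingSet G Z) : Fintype.card V ≤ A.rank + Z.ncard := by
  have hrn := A.mulVecLin.finrank_range_add_finrank_ker
  rw [Module.finrank_fintype_fun_eq_card] at hrn
  let restrict : A.mulVecLin.ker →ₗ[F] (Z → F) :=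
    (LinearMap.funLeft F F (Subtype.val : Z → V)).comp A.mulVecLin.ker.subtype
  have hinj : Function.Injective restrict := by
    rw [← LinearMap.ker_eq_bot, LinearMap.ker_eq_bot']
    rintro ⟨x, hx⟩ h
    ext v
    exact (hZ v).eq_zero hA (by simpa using hx) fun z hz => congrFun h ⟨z, hz⟩
  have hle := LinearMap.finrank_le_finrank_of_injective hinj
  rw [Module.finrank_fintype_fun_eq_card, ← Nat.card_eq_fintype_card,
    Nat.card_coe_set_eq] at hle
  rw [Matrix.rank]
  omega

theorem sMat_adjMat (F : Type*) [Field F] (G : SimpleGraph V) : SMat F G (adjMat F G) := by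
  refine ⟨?_, fun i j _ => by simp [adjMat]⟩
  ext i j
  simp [adjMat, G.adj_comm]

theorem aztecPred_iff {r : ℕ} {p : ℤ × ℤ} :
    AztecPred r p ↔ (r : ℤ) + 1 ≤ p.1 + p.2 ∧ p.1 + p.2 ≤ 3 * (r : ℤ) + 1 ∧
      p.2 - p.1 ≤ r ∧ p.1 - p.2 ≤ r := by
  simp only [AztecPred, abs_le]
  omega

theorem aztec_adj {r : ℕ} {a b : {p : ℤ × ℤ // AztecPred r p}} :
    (aztec r).Adj a b ↔
      (b.1.1 = a.1.1 ∧ b.1.2 = a.1.2 + 1) ∨ (b.1.1 = a.1.1 ∧ b.1.2 = a.1.2 - 1) ∨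
      (b.1.1 = a.1.1 + 1 ∧ b.1.2 = a.1.2) ∨ (b.1.1 = a.1.1 - 1 ∧ b.1.2 = a.1.2) := by
  have hne : a = b ↔ a.1.1 = b.1.1 ∧ a.1.2 = b.1.2 := by rw [Subtype.ext_iff, Prod.ext_iff]
  simp only [aztec, SimpleGraph.fromRel_adj, ne_eq, hne]
  grind

/-- The `2r` diagonals of length `r + 1` that partition `AD_r`: the `t`-th vertex of the diagonal
starting at the leftmost vertex of row `k + 1`. -/
def aztecDiagonal (r : ℕ) (q : Fin (2 * r) × Fin (r + 1)) : {p : ℤ × ℤ // AztecPred r p} :=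
  ⟨if (q.1 : ℕ) < r then (q.1 + 1 + q.2, r - q.1 + q.2) else (q.1 + 1 - q.2, q.1 + 1 - r + q.2), by
    have h1 := q.1.2
    have h2 := q.2.2
    rw [aztecPred_iff]
    split_ifs <;> dsimp only <;> omega⟩

/-- The diagonal of `aztecDiagonal` on which a vertex of `AD_r` lies. -/
def aztecDiagonalIndex (r : ℕ) (p : {p : ℤ × ℤ // AztecPred r p}) : Fin (2 * r) :=
  ⟨((if (p.1.1 + p.1.2 - r) % 2 = 0 then (p.1.1 + p.1.2 + r) / 2
      else (r + 1 + p.1.1 - p.1.2) / 2) - 1).toNat, by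
    have h := aztecPred_iff.1 p.2
    split_ifs <;> omega⟩

theorem aztecDiagonalIndex_aztecDiagonal (r : ℕ) (q : Fin (2 * r) × Fin (r + 1)) :
    aztecDiagonalIndex r (aztecDiagonal r q) = q.1 := by
  have h1 := q.1.2
  have h2 := q.2.2
  ext
  simp only [aztecDiagonalIndex, aztecDiagonal]
  split_ifs <;> dsimp only at * <;> omega

theorem aztecDiagonal_bijective (r : ℕ) : Function.Bijective (aztecDiagonal r) := by
  constructor
  · intro a b hab
    have h : a.1 = b.1 := by
      rw [← aztecDiagonalIndex_aztecDiagonal r a, hab, aztecDiagonalIndex_aztecDiagonal]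
    refine Prod.ext h (Fin.ext ?_)
    have h' := congrArg (fun p => p.1.2) hab
    simp only [aztecDiagonal, h] at h'
    split_ifs at h' <;> dsimp only at h' <;> omega
  · rintro ⟨⟨i, j⟩, hp⟩
    have h := aztecPred_iff.1 hp
    dsimp only at h
    by_cases hpar : (i + j - r) % 2 = 0
    · refine ⟨(⟨((i + j + r) / 2 - 1).toNat, by omega⟩, ⟨((r + j - i) / 2).toNat, by omega⟩), ?_⟩
      apply Subtype.ext
      simp only [aztecDiagonal]
      rw [if_neg (by omega)]
      ext <;> dsimp only <;> omega
    · refine ⟨(⟨((r + 1 + i - j) / 2 - 1).toNat, by omega⟩,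
        ⟨((i + j - r - 1) / 2).toNat, by omega⟩), ?_⟩
      apply Subtype.ext
      simp only [aztecDiagonal]
      rw [if_pos (by omega)]
      ext <;> dsimp only <;> omega

theorem card_aztec (r : ℕ) :
    Fintype.card {p : ℤ × ℤ // AztecPred r p} = 2 * r * (r + 1) := by
  rw [← Fintype.card_of_bijective (aztecDiagonal_bijective r)]
  simp

/-- The leftmost vertices of the rows of `AD_r` form a zero forcing set. -/
theorem isZeroForcingSet_aztec (r : ℕ) :
    IsZeroForcingSet (aztec r) (Set.range fun k => aztecDiagonal r (k, 0)) := by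
  have key : ∀ n : ℕ, ∀ v : {p : ℤ × ℤ // AztecPred r p}, v.1.2 ≤ n →
      Forced (aztec r) (Set.range fun k => aztecDiagonal r (k, 0)) v := by
    intro n
    induction n with
    | zero =>
      intro v hv
      have h := aztecPred_iff.1 v.2
      push_cast at hv
      omega
    | succ n ih =>
      intro v hv
      push_cast at hv
      have h := aztecPred_iff.1 v.2
      by_cases hleft : AztecPred r (v.1.1, v.1.2 - 1)
      · refine Forced.force ⟨_, hleft⟩ v (ih _ (by dsimp only; omega)) ?_ ?_
        · rw [aztec_adj]
          dsimp only
          omega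
        · intro x hx hxv
          apply ih
          rw [aztec_adj] at hx
          rw [ne_eq, Subtype.ext_iff, Prod.ext_iff] at hxv
          dsimp only at hx
          omega
      · rw [aztecPred_iff] at hleft
        dsimp only at hleft
        refine Forced.init v ⟨⟨(v.1.1 - 1).toNat, by omega⟩, Subtype.ext ?_⟩
        simp only [aztecDiagonal]
        split_ifs <;> ext <;> simp <;> omega
  exact fun v => key v.1.2.toNat v (Int.self_le_toNat _)

theorem ncard_range_aztecDiagonal (r : ℕ) :
    (Set.range fun k => aztecDiagonal r (k, 0)).ncard = 2 * r := by
  rw [← Nat.card_coe_set_eq, Nat.card_range_of_injective, Nat.card_fin]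
  exact (aztecDiagonal_bijective r).injective.comp (Prod.mk_left_injective 0)

/-- The alternating vectors on `AD_r`, constant in absolute value along each diagonal. -/
def aztecAlternating (F : Type*) [Field F] (r : ℕ) :
    (Fin (2 * r) → F) →ₗ[F] ({p : ℤ × ℤ // AztecPred r p} → F) where
  toFun g p := (-1) ^ p.1.1 * g (aztecDiagonalIndex r p)
  map_add' g h := by ext p; simp [mul_add]
  map_smul' c g := by ext p; simp [mul_left_comm]

theorem aztecAlternating_injective (F : Type*) [Field F] (r : ℕ) :
    Function.Injective (aztecAlternating F r) := by
  intro g h hgh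
  ext k
  have hk := congrFun hgh (aztecDiagonal r (k, 0))
  simp only [aztecAlternating, LinearMap.coe_mk, AddHom.coe_mk,
    aztecDiagonalIndex_aztecDiagonal] at hk
  exact mul_left_cancel₀ (zpow_ne_zero _ (neg_ne_zero.2 one_ne_zero)) hk

/-- The neighbors of a vertex of `AD_r` pair up: each diagonal meeting the neighborhood meets it
in two vertices, which lie in consecutive rows. -/
theorem exists_involution_neighbors {r : ℕ} (x : {p : ℤ × ℤ // AztecPred r p}) :
    ∃ φ : {p : ℤ × ℤ // AztecPred r p} → {p : ℤ × ℤ // AztecPred r p},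
      ∀ y, (aztec r).Adj x y → (aztec r).Adj x (φ y) ∧ φ (φ y) = y ∧
        aztecDiagonalIndex r (φ y) = aztecDiagonalIndex r y ∧
        ((φ y).1.1 = y.1.1 + 1 ∨ y.1.1 = (φ y).1.1 + 1) := by
  let s : ℤ := if (x.1.1 + x.1.2 - r) % 2 = 0 then -1 else 1
  let ψ : ℤ × ℤ → ℤ × ℤ := fun y => (x.1.1 + s * (y.2 - x.1.2), x.1.2 + s * (y.1 - x.1.1))
  have hx := aztecPred_iff.1 x.2
  have hs : (x.1.1 + x.1.2 - r) % 2 = 0 ∧ s = -1 ∨ (x.1.1 + x.1.2 - r) % 2 ≠ 0 ∧ s = 1 := by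
    by_cases h : (x.1.1 + x.1.2 - r) % 2 = 0 <;> simp [s, h]
  have hψ : ∀ y, (aztec r).Adj x y → AztecPred r (ψ y.1) := by
    intro y hy
    have h := aztecPred_iff.1 y.2
    rw [aztec_adj] at hy
    rw [aztecPred_iff]
    dsimp only [ψ]
    rcases hs with ⟨hp, hs⟩ | ⟨hp, hs⟩ <;> rw [hs] <;> omega
  refine ⟨fun y => if h : AztecPred r (ψ y.1) then ⟨ψ y.1, h⟩ else y, fun y hy => ?_⟩
  have hadj : (aztec r).Adj x ⟨ψ y.1, hψ y hy⟩ := by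
    rw [aztec_adj] at hy ⊢
    dsimp only [ψ]
    rcases hs with ⟨hp, hs⟩ | ⟨hp, hs⟩ <;> rw [hs] <;> omega
  have h' : AztecPred r (ψ (ψ y.1)) := hψ _ hadj
  simp only [dif_pos (hψ y hy), dif_pos h']
  refine ⟨hadj, ?_, ?_, ?_⟩
  · apply Subtype.ext
    dsimp only [ψ]
    rcases hs with ⟨hp, hs⟩ | ⟨hp, hs⟩ <;> rw [hs] <;> ext <;> dsimp only <;> ring
  · rw [aztec_adj] at hy
    ext
    simp only [aztecDiagonalIndex, ψ]
    rcases hs with ⟨hp, hs⟩ | ⟨hp, hs⟩ <;> simp only [hs] <;> split_ifs <;> omega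
  · rw [aztec_adj] at hy
    dsimp only [ψ]
    rcases hs with ⟨hp, hs⟩ | ⟨hp, hs⟩ <;> rw [hs] <;> omega

theorem adjMat_mulVec_aztecAlternating (F : Type*) [Field F] (r : ℕ) (g : Fin (2 * r) → F) :
    (adjMat F (aztec r)).mulVec (aztecAlternating F r g) = 0 := by
  ext x
  obtain ⟨φ, hφ⟩ := exists_involution_neighbors x
  have hcancel : ∀ y, (aztec r).Adj x y →
      aztecAlternating F r g y + aztecAlternating F r g (φ y) = 0 := by
    intro y hy
    obtain ⟨-, -, hidx, hrow⟩ := hφ y hy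
    have h0 : (-1 : F) ≠ 0 := neg_ne_zero.2 one_ne_zero
    simp only [aztecAlternating, LinearMap.coe_mk, AddHom.coe_mk, hidx]
    rcases hrow with h | h <;> rw [h, zpow_add_one₀ h0] <;> ring
  have hsum : (adjMat F (aztec r)).mulVec (aztecAlternating F r g) x =
      ∑ y with (aztec r).Adj x y, aztecAlternating F r g y := by
    simp [Matrix.mulVec, dotProduct, adjMat, Finset.sum_filter]
  rw [hsum]
  refine Finset.sum_involution (fun y _ => φ y) ?_ ?_ ?_ ?_
  · intro y hy
    exact hcancel y (Finset.mem_filter.1 hy).2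
  · intro y hy _ h
    obtain ⟨-, -, -, hrow⟩ := hφ y (Finset.mem_filter.1 hy).2
    rw [h] at hrow
    omega
  · intro y hy
    simpa using (hφ y (Finset.mem_filter.1 hy).2).1
  · intro y hy
    exact (hφ y (Finset.mem_filter.1 hy).2).2.1

theorem rank_adjMat_aztec_add_le (F : Type*) [Field F] (r : ℕ) :
    (adjMat F (aztec r)).rank + 2 * r ≤ 2 * r * (r + 1) := by
  have hrn := (adjMat F (aztec r)).mulVecLin.finrank_range_add_finrank_ker
  rw [Module.finrank_fintype_fun_eq_card, card_aztec] at hrn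
  have hinj : Function.Injective ((aztecAlternating F r).codRestrict
      (adjMat F (aztec r)).mulVecLin.ker (adjMat_mulVec_aztecAlternating F r)) :=
    (LinearMap.injective_codRestrict_iff _).2 (aztecAlternating_injective F r)
  have hle := LinearMap.finrank_le_finrank_of_injective hinj
  rw [Module.finrank_fintype_fun_eq_card, Fintype.card_fin] at hle
  rw [Matrix.rank]
  omega

theorem stmt5 (r : ℕ) (hr : 1 ≤ r) :
    ∀ (F : Type) [Field F],
      maxNullity F (aztec r) = zfn (aztec r) ∧
      zfn (aztec r) = 2 * r ∧
      Fintype.card {p : ℤ × ℤ // AztecPred r p} = 2 * r * (r + 1) ∧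
      (adjMat F (aztec r)).rank = 2 * r * (r + 1) - 2 * r ∧
      minRank F (aztec r) = (adjMat F (aztec r)).rank := by
  intro F _
  have hcard := card_aztec r
  have hncard := ncard_range_aztecDiagonal r
  have hforcing := isZeroForcingSet_aztec r
  have hrank_le := rank_adjMat_aztec_add_le F r
  have hlower : ∀ A, SMat F (aztec r) A → 2 * r * (r + 1) ≤ A.rank + 2 * r := fun A hA => by
    simpa only [hcard, hncard] using hforcing.card_le_rank_add_ncard hA
  have hadj := sMat_adjMat F (aztec r)
  have hrank := hlower _ hadj
  have hzfn : zfn (aztec r) = 2 * r := by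
    refine IsLeast.csInf_eq ⟨⟨_, hncard, hforcing⟩, ?_⟩
    rintro m ⟨Z, rfl, hZ⟩
    have h := hZ.card_le_rank_add_ncard hadj
    omega
  have hnull : maxNullity F (aztec r) = 2 * r := by
    refine IsGreatest.csSup_eq ⟨⟨_, hadj, by omega⟩, ?_⟩
    rintro m ⟨A, hA, rfl⟩
    have h := hlower A hA
    omega
  refine ⟨hnull.trans hzfn.symm, hzfn, hcard, by omega, ?_⟩
  refine IsLeast.csInf_eq ⟨⟨_, hadj, rfl⟩, ?_⟩
  rintro m ⟨A, hA, rfl⟩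
  have h := hlower A hA
  omega

end Paper
end
end

section
/- For every integer n ≥ 8, the graph G = C_n □ P_3 satisfies ξ(G) = M(G) = Z(G) = 6. -/
open scoped Classical

noncomputable section

namespace Paper

variable {V : Type*}

/-- A kernel vector of a matrix in `S(F,G)` vanishing on `Z` vanishes on all vertices forced
by `Z`. -/
theorem Forced.eq_zero_of_mulVec_eq_zero {F : Type*} [Field F] [Fintype V] {G : SimpleGraph V}
    {Z : Set V} {A : Matrix V V F} (hA : SMat F G A) {x : V → F} (hx : A.mulVec x = 0)
    (hZ : ∀ v ∈ Z, x v = 0) {v : V} (hv : Forced G Z v) : x v = 0 := by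
  induction hv with
  | init v h => exact hZ v h
  | force u w _ huw _ ihu ih =>
    have h := congrFun hx u
    simp only [Matrix.mulVec, dotProduct, Pi.zero_apply] at h
    rw [Finset.sum_eq_single w] at h
    · exact (mul_eq_zero.mp h).resolve_left ((hA.2 u w huw.ne).2 huw)
    · intro y _ hyw
      by_cases hyu : u = y
      · rw [← hyu, ihu, mul_zero]
      · by_cases hadj : G.Adj u y
        · rw [ih y hadj hyw, mul_zero]
        · rw [not_not.mp fun h0 => hadj ((hA.2 u y hyu).1 h0), zero_mul]
    · simp

theorem card_sub_rank_eq_finrank_ker {F : Type*} [Field F] [Fintype V] (A : Matrix V V F) :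
    Fintype.card V - A.rank = Module.finrank F (LinearMap.ker A.mulVecLin) := by
  have h := LinearMap.finrank_range_add_finrank_ker A.mulVecLin
  rw [Module.finrank_fintype_fun_eq_card] at h
  rw [Matrix.rank]
  omega

/-- The nullity of a matrix in `S(F,G)` is at most the size of any zero forcing set. -/
theorem IsZeroForcingSet.card_sub_rank_le {F : Type*} [Field F] [Fintype V] {G : SimpleGraph V}
    {Z : Set V} (hZ : IsZeroForcingSet G Z) {A : Matrix V V F} (hA : SMat F G A) :
    Fintype.card V - A.rank ≤ Z.ncard := by
  rw [card_sub_rank_eq_finrank_ker]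
  let f : LinearMap.ker A.mulVecLin →ₗ[F] (Z → F) :=
    (LinearMap.funLeft F F ((↑) : Z → V)).comp (Submodule.subtype _)
  have hf : Function.Injective f := by
    rw [injective_iff_map_eq_zero]
    rintro ⟨x, hx⟩ h
    ext v
    exact (hZ v).eq_zero_of_mulVec_eq_zero hA (by simpa using hx)
      fun v hv => congrFun h ⟨v, hv⟩
  have h := LinearMap.finrank_le_finrank_of_injective hf
  rwa [Module.finrank_fintype_fun_eq_card, ← Nat.card_eq_fintype_card, Nat.card_coe_set_eq] at h

section CyclePath

variable {n : ℕ}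

theorem circG_one_adj (hn : 8 ≤ n) (s t : ZMod n) :
    (circG n {1}).Adj s t ↔ t = s + 1 ∨ t = s - 1 := by
  have : Fact (1 < n) := ⟨by omega⟩
  simp only [circG, SimpleGraph.fromRel_adj, Set.mem_singleton_iff, exists_eq_left, Nat.cast_one,
    ne_eq]
  constructor
  · rintro ⟨_, h | h⟩
    · exact Or.inl h
    · exact Or.inr (by rw [h]; ring)
  · rintro (rfl | rfl)
    · simp
    · exact ⟨fun h => one_ne_zero (by linear_combination h), Or.inr (by ring)⟩

/-- Two consecutive copies of the path force the whole product of a cycle and a path. -/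
theorem isZeroForcingSet_two_columns (hn : 8 ≤ n) :
    IsZeroForcingSet ((circG n {1}).boxProd (SimpleGraph.pathGraph 3))
      (({0, 1} : Set (ZMod n)) ×ˢ (Set.univ : Set (Fin 3))) := by
  have key : ∀ k : ℕ, ∀ p : Fin 3,
      Forced ((circG n {1}).boxProd (SimpleGraph.pathGraph 3))
        (({0, 1} : Set (ZMod n)) ×ˢ (Set.univ : Set (Fin 3))) ((k : ZMod n), p) := by
    intro k
    induction k using Nat.strong_induction_on with
    | _ k ih =>
      intro p
      match k, ih with
      | 0, _ => exact Forced.init _ (by simp)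
      | 1, _ => exact Forced.init _ (by simp)
      | k + 2, ih =>
        refine Forced.force (((k + 1 : ℕ) : ZMod n), p) _ (ih (k + 1) (by omega) p) ?_ ?_
        · rw [SimpleGraph.boxProd_adj]
          refine Or.inl ⟨(circG_one_adj hn _ _).2 (Or.inl ?_), rfl⟩
          push_cast
          ring
        · rintro ⟨t, q⟩ h hne
          rw [SimpleGraph.boxProd_adj] at h
          rcases h with ⟨h, hq⟩ | ⟨-, ht⟩
          · simp only at h hq
            rcases (circG_one_adj hn _ _).1 h with rfl | rfl
            · refine absurd ?_ hne
              ext1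
              · push_cast
                ring
              · exact hq.symm
            · have h := ih k (by omega) q
              convert h using 2
              push_cast
              ring
          · simp only at ht
            rw [← ht]
            exact ih (k + 1) (by omega) q
  have : NeZero n := ⟨by omega⟩
  rintro ⟨t, p⟩
  have h := key t.val p
  rwa [ZMod.natCast_zmod_val] at h

theorem ncard_two_columns (hn : 8 ≤ n) :
    (({0, 1} : Set (ZMod n)) ×ˢ (Set.univ : Set (Fin 3))).ncard = 6 := by
  have : Fact (1 < n) := ⟨by omega⟩
  rw [Set.ncard_prod, Set.ncard_pair zero_ne_one, Set.ncard_univ, Nat.card_eq_fintype_card,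
    Fintype.card_fin]

/-- The persymmetric tridiagonal matrix with diagonal `a, c, a` and off-diagonal entries `b`. -/
def tridiag (a b c : ℝ) : Matrix (Fin 3) (Fin 3) ℝ := !![a, b, 0; b, c, b; 0, b, a]

/-- The matrix `A(C_n) ⊗ I + I ⊗ B`. -/
def cycleKron (n : ℕ) (B : Matrix (Fin 3) (Fin 3) ℝ) :
    Matrix (ZMod n × Fin 3) (ZMod n × Fin 3) ℝ :=
  Matrix.of fun i j => (if j = (i.1 + 1, i.2) then 1 else 0) +
    (if j = (i.1 - 1, i.2) then 1 else 0) + (if j.1 = i.1 then B i.2 j.2 else 0)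

theorem cycleKron_mulVec [NeZero n] (B : Matrix (Fin 3) (Fin 3) ℝ) (x : ZMod n × Fin 3 → ℝ)
    (s : ZMod n) (p : Fin 3) :
    (cycleKron n B).mulVec x (s, p) =
      x (s + 1, p) + x (s - 1, p) + ∑ q, B p q * x (s, q) := by
  simp only [Matrix.mulVec, dotProduct, cycleKron, Matrix.of_apply, add_mul,
    Finset.sum_add_distrib, ite_mul, one_mul, zero_mul, Finset.sum_ite_eq',
    Finset.mem_univ, if_true]
  congr 1
  rw [Fintype.sum_prod_type, Finset.sum_eq_single s]
  · simp
  · intro t _ h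
    simp [h]
  · simp

theorem smat_cycleKron (hn : 8 ≤ n) (a : ℝ) {b : ℝ} (hb : b ≠ 0) (c : ℝ) :
    SMat ℝ ((circG n {1}).boxProd (SimpleGraph.pathGraph 3)) (cycleKron n (tridiag a b c)) := by
  have : Fact (1 < n) := ⟨by omega⟩
  have h2 : (1 : ZMod n) + 1 ≠ 0 := by
    have h : ((2 : ℕ) : ZMod n) ≠ 0 := by
      rw [Ne, ZMod.natCast_eq_zero_iff]
      exact fun h => by have := Nat.le_of_dvd (by norm_num) h; omega
    intro h'
    apply h
    push_cast
    rw [← h']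
    norm_num
  have hsub : ∀ s : ZMod n, s + 1 ≠ s - 1 := fun s h => h2 (by linear_combination h)
  have h1 : ∀ s : ZMod n, s + 1 ≠ s := fun s h => one_ne_zero (by linear_combination h)
  have h1' : ∀ s : ZMod n, s - 1 ≠ s := fun s h => one_ne_zero (by linear_combination -h)
  constructor
  · ext ⟨s, p⟩ ⟨t, q⟩
    have e1 : s = t + 1 ↔ t = s - 1 :=
      ⟨fun h => by rw [h]; ring, fun h => by rw [h]; ring⟩
    have e2 : s = t - 1 ↔ t = s + 1 :=
      ⟨fun h => by rw [h]; ring, fun h => by rw [h]; ring⟩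
    have hB : tridiag a b c q p = tridiag a b c p q := by
      fin_cases p <;> fin_cases q <;> rfl
    simp only [Matrix.transpose_apply, cycleKron, Matrix.of_apply, Prod.mk.injEq, e1, e2, hB,
      eq_comm (a := p), eq_comm (a := s)]
    ring
  · rintro ⟨s, p⟩ ⟨t, q⟩ hne
    rw [SimpleGraph.boxProd_adj, circG_one_adj hn, SimpleGraph.pathGraph_adj]
    simp only [cycleKron, Matrix.of_apply, Prod.mk.injEq]
    by_cases e1 : t = s + 1
    · subst e1
      by_cases hpq : q = p <;> simp [hpq, hsub, h1, eq_comm (a := p), (h1 s).symm]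
    · by_cases e2 : t = s - 1
      · subst e2
        by_cases hpq : q = p <;> simp [hpq, (hsub s).symm, h1', eq_comm (a := p), (h1' s).symm]
      · by_cases e3 : t = s
        · subst e3
          simp only [e1, e2]
          fin_cases p <;> fin_cases q <;> simp_all [tridiag]
        · simp [e1, e2, e3, eq_comm (a := s)]

theorem hasSAP_cycleKron [NeZero n] (a : ℝ) {b : ℝ} (hb : b ≠ 0) (c : ℝ)
    (hS : SMat ℝ ((circG n {1}).boxProd (SimpleGraph.pathGraph 3))
      (cycleKron n (tridiag a b c))) (hn : 8 ≤ n) :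
    HasSAP (cycleKron n (tridiag a b c)) := by
  intro X hX hAX hAX0 hIX
  have hdiag : ∀ i, X i i = 0 := fun i => by
    simpa [Matrix.hadamard] using congrFun (congrFun hIX i) i
  have hsymm : ∀ i j, X j i = X i j := fun i j => hX.apply i j
  have hadj : ∀ i j, ((circG n {1}).boxProd (SimpleGraph.pathGraph 3)).Adj i j → X i j = 0 := by
    intro i j h
    have h0 := congrFun (congrFun hAX0 i) j
    exact (mul_eq_zero.mp h0).resolve_left ((hS.2 i j h.ne).2 h)
  have hrow : ∀ s p j, X (s + 1, p) j + X (s - 1, p) j +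
      ∑ q, tridiag a b c p q * X (s, q) j = 0 := by
    intro s p j
    rw [← cycleKron_mulVec (tridiag a b c) (fun i => X i j)]
    exact congrFun (congrFun hAX (s, p)) j
  have hhor : ∀ t p, X (t + 1, p) (t, p) = 0 := fun t p => by
    rw [hsymm]
    apply hadj
    rw [SimpleGraph.boxProd_adj]
    exact Or.inl ⟨(circG_one_adj hn _ _).2 (Or.inl rfl), rfl⟩
  have hver : ∀ t p q, (SimpleGraph.pathGraph 3).Adj p q → X (t, p) (t, q) = 0 :=
    fun t p q h => hadj _ _ (by rw [SimpleGraph.boxProd_adj]; exact Or.inr ⟨h, rfl⟩)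
  have v01 : ∀ t, X (t, 0) (t, 1) = 0 := fun t => hver t 0 1 (by simp [SimpleGraph.pathGraph_adj])
  have v10 : ∀ t, X (t, 1) (t, 0) = 0 := fun t => hver t 1 0 (by simp [SimpleGraph.pathGraph_adj])
  have v12 : ∀ t, X (t, 1) (t, 2) = 0 := fun t => hver t 1 2 (by simp [SimpleGraph.pathGraph_adj])
  have v21 : ∀ t, X (t, 2) (t, 1) = 0 := fun t => hver t 2 1 (by simp [SimpleGraph.pathGraph_adj])
  have r0 : ∀ s j, X (s + 1, 0) j + X (s - 1, 0) j + (a * X (s, 0) j + b * X (s, 1) j) = 0 :=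
    fun s j => by simpa [tridiag, Fin.sum_univ_three] using hrow s 0 j
  have r1 : ∀ s j, X (s + 1, 1) j + X (s - 1, 1) j +
      (b * X (s, 0) j + c * X (s, 1) j + b * X (s, 2) j) = 0 :=
    fun s j => by simpa [tridiag, Fin.sum_univ_three] using hrow s 1 j
  have r2 : ∀ s j, X (s + 1, 2) j + X (s - 1, 2) j + (b * X (s, 1) j + a * X (s, 2) j) = 0 :=
    fun s j => by simpa [tridiag, Fin.sum_univ_three] using hrow s 2 j
  have hs1 : ∀ t : ZMod n, t + 1 - 1 = t := fun t => by ring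
  -- compare two computations of the entries of `X` in columns at distance two
  have c0 : ∀ t, X (t + 1, 1) (t, 0) = X (t + 1 + 1, 0) (t + 1, 1) := by
    intro t
    have e1 := r0 (t + 1) (t, 0)
    have e2 := r0 (t + 1) (t + 1 + 1, 0)
    rw [hs1, hdiag, hhor] at e1
    rw [hs1, hdiag, hsymm (t + 1 + 1, 0), hsymm (t + 1 + 1, 0) (t + 1, 0), hhor,
      hsymm (t + 1 + 1, 0) (t + 1, 1)] at e2
    exact mul_left_cancel₀ hb (by linarith)
  have c2 : ∀ t, X (t + 1, 1) (t, 2) = X (t + 1 + 1, 2) (t + 1, 1) := by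
    intro t
    have e1 := r2 (t + 1) (t, 2)
    have e2 := r2 (t + 1) (t + 1 + 1, 2)
    rw [hs1, hdiag, hhor] at e1
    rw [hs1, hdiag, hsymm (t + 1 + 1, 2), hsymm (t + 1 + 1, 2) (t + 1, 2), hhor,
      hsymm (t + 1 + 1, 2) (t + 1, 1)] at e2
    exact mul_left_cancel₀ hb (by linarith)
  have d0 : ∀ t, X (t + 1 + 1, 0) (t + 1, 1) + X (t + 1, 1) (t, 0) = 0 := by
    intro t
    have e := r0 (t + 1) (t + 1, 1)
    rw [hs1, v01, hdiag, hsymm (t + 1, 1) (t, 0)] at e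
    linarith
  have d2 : ∀ t, X (t + 1 + 1, 2) (t + 1, 1) + X (t + 1, 1) (t, 2) = 0 := by
    intro t
    have e := r2 (t + 1) (t + 1, 1)
    rw [hs1, v21, hdiag, hsymm (t + 1, 1) (t, 2)] at e
    linarith
  have y10 : ∀ t, X (t + 1, 1) (t, 0) = 0 := fun t => by linarith [c0 t, d0 t]
  have y12 : ∀ t, X (t + 1, 1) (t, 2) = 0 := fun t => by linarith [c2 t, d2 t]
  have y01 : ∀ t, X (t + 1, 0) (t, 1) = 0 := fun t => by
    have e := d0 (t - 1)
    rw [sub_add_cancel] at e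
    have e' := y10 (t - 1)
    rw [sub_add_cancel] at e'
    linarith
  have y21 : ∀ t, X (t + 1, 2) (t, 1) = 0 := fun t => by
    have e := d2 (t - 1)
    rw [sub_add_cancel] at e
    have e' := y12 (t - 1)
    rw [sub_add_cancel] at e'
    linarith
  have v20 : ∀ t, X (t, 2) (t, 0) = 0 := by
    intro t
    have e := r1 t (t, 0)
    have e' := y01 (t - 1)
    rw [sub_add_cancel] at e'
    rw [y10, v10, hdiag, hsymm (t, 0), e'] at e
    exact (mul_eq_zero.mp (by linarith : b * X (t, 2) (t, 0) = 0)).resolve_left hb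
  have v02 : ∀ t, X (t, 0) (t, 2) = 0 := fun t => by rw [hsymm]; exact v20 t
  have y20 : ∀ t, X (t + 1, 2) (t, 0) = 0 := by
    intro t
    have e1 := r1 (t + 1) (t, 0)
    have e2 := r0 (t + 1) (t + 1 + 1, 1)
    rw [hs1, v10, hhor, y10] at e1
    rw [hs1, v01, hsymm (t + 1 + 1, 1) (t, 0), hsymm (t + 1 + 1, 1) (t + 1, 0), y10,
      hsymm (t + 1 + 1, 1) (t + 1, 1), hhor] at e2
    exact (mul_eq_zero.mp (by linarith : b * X (t + 1, 2) (t, 0) = 0)).resolve_left hb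
  have y02 : ∀ t, X (t + 1, 0) (t, 2) = 0 := by
    intro t
    have e := r0 t (t, 2)
    have e' := y20 (t - 1)
    rw [sub_add_cancel] at e'
    rw [v02, v12, hsymm (t, 2) (t - 1, 0), e'] at e
    linarith
  have b0 : ∀ t p q, X (t, p) (t, q) = 0 := by
    intro t p q
    fin_cases p <;> fin_cases q <;> 
      first
      | exact hdiag _
      | exact v01 t
      | exact v10 t
      | exact v12 t
      | exact v21 t
      | exact v02 t
      | exact v20 t
  have b1 : ∀ t p q, X (t + 1, p) (t, q) = 0 := by
    intro t p q
    fin_cases p <;> fin_cases q <;> 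
      first
      | exact hhor _ _
      | exact y01 t
      | exact y10 t
      | exact y12 t
      | exact y21 t
      | exact y02 t
      | exact y20 t
  have hall : ∀ (k : ℕ) t p q, X (t + k, p) (t, q) = 0 ∧ X (t + k + 1, p) (t, q) = 0 := by
    intro k
    induction k with
    | zero => exact fun t p q => by simpa using ⟨b0 t p q, b1 t p q⟩
    | succ k ih =>
      intro t p q
      rw [Nat.cast_succ, ← add_assoc]
      refine ⟨(ih t p q).2, ?_⟩
      have e := hrow (t + k + 1) p (t, q)
      rw [hs1, (ih t p q).1, Finset.sum_eq_zero fun q' _ => by rw [(ih t q' q).2, mul_zero]] at e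
      linarith
  ext ⟨s, p⟩ ⟨t, q⟩
  have h := (hall (s - t).val t p q).1
  rwa [ZMod.natCast_zmod_val, add_sub_cancel] at h

/-- A function on `ℤ` with period `n` is compatible with addition in `ZMod n`. -/
theorem periodic_zmod_add_intCast {f : ℤ → ℝ} (hf : Function.Periodic f n) (t : ZMod n) (m : ℤ) :
    f ((t + m : ZMod n).cast) = f (t.cast + m) := by
  have h : (((t + m : ZMod n).cast : ℤ) : ZMod n) = ((t.cast + m : ℤ) : ZMod n) := by
    push_cast
    simp
  rw [ZMod.intCast_eq_intCast_iff_dvd_sub] at h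
  obtain ⟨k, hk⟩ := h
  rw [show (t.cast + m : ℤ) = (t + m : ZMod n).cast + k * n by linarith]
  exact ((hf.int_mul k) _).symm

/-- The wave `m ↦ α cos (2πkm/n) + β sin (2πkm/n)`. -/
def wave (n k : ℕ) (α β : ℝ) (m : ℤ) : ℝ :=
  α * Real.cos (2 * Real.pi * k / n * m) + β * Real.sin (2 * Real.pi * k / n * m)

theorem wave_periodic [NeZero n] (k : ℕ) (α β : ℝ) : Function.Periodic (wave n k α β) n := by
  intro m
  have hn : (n : ℝ) ≠ 0 := Nat.cast_ne_zero.2 (NeZero.ne n)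
  have h : 2 * Real.pi * k / n * ((m + n : ℤ) : ℝ) =
      2 * Real.pi * k / n * m + k * (2 * Real.pi) := by
    push_cast
    field_simp
  rw [wave, h, Real.cos_add_nat_mul_two_pi, Real.sin_add_nat_mul_two_pi, wave]

theorem wave_add_wave (k : ℕ) (α β : ℝ) (m : ℤ) :
    wave n k α β (m + 1) + wave n k α β (m + (-1 : ℤ)) =
      2 * Real.cos (2 * Real.pi * k / n) * wave n k α β m := by
  simp only [wave]
  push_cast
  rw [mul_add, mul_add, mul_one, mul_neg, mul_one, Real.cos_add, Real.cos_add, Real.sin_add,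
    Real.sin_add, Real.cos_neg, Real.sin_neg]
  ring

theorem wave_zmod [NeZero n] (k : ℕ) (α β : ℝ) (t : ZMod n) :
    wave n k α β (t + 1 : ZMod n).cast + wave n k α β (t - 1 : ZMod n).cast =
      2 * Real.cos (2 * Real.pi * k / n) * wave n k α β t.cast := by
  have h1 := periodic_zmod_add_intCast (wave_periodic k α β) t 1
  have h2 := periodic_zmod_add_intCast (wave_periodic k α β) t (-1)
  rw [Int.cast_one] at h1
  rw [Int.cast_neg, Int.cast_one, ← sub_eq_add_neg] at h2
  rw [h1, h2, wave_add_wave]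

/-- The superposition of the waves of frequencies `1, 2, 3` along the directions `u k`. -/
def waveVec (n : ℕ) (u : Fin 3 → Fin 3 → ℝ) :
    (Fin 3 → ℝ) × (Fin 3 → ℝ) →ₗ[ℝ] (ZMod n × Fin 3 → ℝ) where
  toFun w i := ∑ k : Fin 3, wave n (k + 1) (w.1 k) (w.2 k) i.1.cast * u k i.2
  map_add' w w' := by
    ext i
    simp only [wave, Prod.fst_add, Prod.snd_add, Pi.add_apply, ← Finset.sum_add_distrib]
    exact Finset.sum_congr rfl fun k _ => by ring
  map_smul' r w := by
    ext i
    simp only [wave, Prod.smul_fst, Prod.smul_snd, Pi.smul_apply, smul_eq_mul, Finset.mul_sum,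
      RingHom.id_apply]
    exact Finset.sum_congr rfl fun k _ => by ring

theorem cycleKron_mulVec_waveVec [NeZero n] {B : Matrix (Fin 3) (Fin 3) ℝ}
    {u : Fin 3 → Fin 3 → ℝ}
    (hu : ∀ k : Fin 3, B.mulVec (u k) =
      (-2 * Real.cos (2 * Real.pi * ((k + 1 : ℕ) : ℝ) / n)) • u k)
    (w : (Fin 3 → ℝ) × (Fin 3 → ℝ)) : (cycleKron n B).mulVec (waveVec n u w) = 0 := by
  ext ⟨s, p⟩
  rw [cycleKron_mulVec]
  simp only [waveVec, LinearMap.coe_mk, AddHom.coe_mk, Pi.zero_apply, Finset.mul_sum]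
  rw [Finset.sum_comm, ← Finset.sum_add_distrib, ← Finset.sum_add_distrib]
  refine Finset.sum_eq_zero fun k _ => ?_
  have h1 := congrFun (hu k) p
  have h2 := wave_zmod (n := n) (k + 1) (w.1 k) (w.2 k) s
  simp only [Matrix.mulVec, dotProduct, Pi.smul_apply, smul_eq_mul] at h1
  have h3 : ∑ q, B p q * (wave n (k + 1) (w.1 k) (w.2 k) s.cast * u k q) =
      wave n (k + 1) (w.1 k) (w.2 k) s.cast * ∑ q, B p q * u k q := by
    rw [Finset.mul_sum]
    exact Finset.sum_congr rfl fun q _ => by ring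
  rw [h3, h1]
  linear_combination u k p * h2

theorem waveVec_injective (hn : 8 ≤ n) {u : Fin 3 → Fin 3 → ℝ} (hu : LinearIndependent ℝ u) :
    Function.Injective (waveVec n u) := by
  have : NeZero n := ⟨by omega⟩
  have hn' : (8 : ℝ) ≤ n := by exact_mod_cast hn
  rw [Fintype.linearIndependent_iff] at hu
  rw [injective_iff_map_eq_zero]
  rintro ⟨α, β⟩ h
  have hα : ∀ k, α k = 0 := by
    apply hu
    ext p
    simpa [waveVec, wave] using congrFun h (0, p)
  have hβ : ∀ k : Fin 3, β k * Real.sin (2 * Real.pi * ((k + 1 : ℕ) : ℝ) / n) = 0 := by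
    apply hu
    ext p
    have h0 := congrFun h (0 + ((1 : ℤ) : ZMod n), p)
    simp only [waveVec, LinearMap.coe_mk, AddHom.coe_mk, Pi.zero_apply,
      periodic_zmod_add_intCast (wave_periodic _ _ _)] at h0
    simpa [wave, hα] using h0
  have hsin : ∀ k : Fin 3, Real.sin (2 * Real.pi * ((k + 1 : ℕ) : ℝ) / n) ≠ 0 := by
    intro k
    have hk : (((k : ℕ) + 1 : ℕ) : ℝ) ≤ 3 := by exact_mod_cast k.2
    have hk0 : (0 : ℝ) < (((k : ℕ) + 1 : ℕ) : ℝ) := by positivity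
    refine (Real.sin_pos_of_pos_of_lt_pi (by positivity) ?_).ne'
    rw [div_lt_iff₀ (by positivity)]
    nlinarith [Real.pi_pos]
  refine Prod.ext (funext hα) (funext fun k => ?_)
  exact (mul_eq_zero.mp (hβ k)).resolve_right (hsin k)

theorem cos_strictAnti_of_lt (hn : 8 ≤ n) {j k : ℕ} (hjk : j < k) (hk : k ≤ 3) :
    Real.cos (2 * Real.pi * k / n) < Real.cos (2 * Real.pi * j / n) := by
  have hn' : (8 : ℝ) ≤ n := by exact_mod_cast hn
  have hk' : (k : ℝ) ≤ 3 := by exact_mod_cast hk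
  have hjk' : (j : ℝ) < k := by exact_mod_cast hjk
  apply Real.cos_lt_cos_of_nonneg_of_le_pi (by positivity)
  · rw [div_le_iff₀ (by positivity)]
    nlinarith [Real.pi_pos]
  · gcongr

/-- A persymmetric tridiagonal matrix with three prescribed distinct eigenvalues. -/
theorem exists_tridiag_eigenvectors {x y z : ℝ} (hxy : x < y) (hyz : y < z) :
    ∃ a b c : ℝ, b ≠ 0 ∧ ∃ u : Fin 3 → Fin 3 → ℝ, LinearIndependent ℝ u ∧
      ∀ k, (tridiag a b c).mulVec (u k) = (![x, y, z] k) • u k := by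
  have hpos : 0 < (y - x) * (z - y) / 2 :=
    div_pos (mul_pos (sub_pos.2 hxy) (sub_pos.2 hyz)) two_pos
  set b := Real.sqrt ((y - x) * (z - y) / 2)
  have hbb : b * b = (y - x) * (z - y) / 2 := Real.mul_self_sqrt hpos.le
  have hb0 : b ≠ 0 := (Real.sqrt_pos.2 hpos).ne'
  refine ⟨y, b, x + z - y, hb0, ![![b, x - y, b], ![1, 0, -1], ![b, z - y, b]], ?_, ?_⟩
  · rw [Fintype.linearIndependent_iff]
    intro g hg
    have e0 := congrFun hg 0
    have e1 := congrFun hg 1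
    have e2 := congrFun hg 2
    simp [Fin.sum_univ_three] at e0 e1 e2
    have g1 : g 1 = 0 := by linarith
    have g02 : g 0 + g 2 = 0 :=
      (mul_eq_zero.mp (by linarith : b * (g 0 + g 2) = 0)).resolve_left hb0
    have g2 : g 2 = 0 := by
      refine (mul_eq_zero.mp (?_ : (z - x) * g 2 = 0)).resolve_left (by linarith)
      linear_combination e1 - (x - y) * g02
    intro k
    fin_cases k
    · change g 0 = 0
      linarith
    · exact g1
    · exact g2
  · intro k
    fin_cases k <;> ext p <;> fin_cases p <;>
      simp [tridiag, Matrix.mulVec, dotProduct, Fin.sum_univ_three] <;>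
      first | linear_combination 2 * hbb | ring

/-- The product of a cycle and `P₃` has a matrix with the Strong Arnold Property and
nullity `6`. -/
theorem exists_smat_hasSAP_nullity_six [NeZero n] (hn : 8 ≤ n) :
    ∃ A : Matrix (ZMod n × Fin 3) (ZMod n × Fin 3) ℝ,
      SMat ℝ ((circG n {1}).boxProd (SimpleGraph.pathGraph 3)) A ∧ HasSAP A ∧
        Fintype.card (ZMod n × Fin 3) - A.rank = 6 := by
  obtain ⟨a, b, c, hb, u, hu, hev⟩ := exists_tridiag_eigenvectors
    (x := -2 * Real.cos (2 * Real.pi * ((1 : ℕ) : ℝ) / n))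
    (y := -2 * Real.cos (2 * Real.pi * ((2 : ℕ) : ℝ) / n))
    (z := -2 * Real.cos (2 * Real.pi * ((3 : ℕ) : ℝ) / n))
    (by linarith [cos_strictAnti_of_lt hn (j := 1) (k := 2) (by norm_num) (by norm_num)])
    (by linarith [cos_strictAnti_of_lt hn (j := 2) (k := 3) (by norm_num) (by norm_num)])
  have hS := smat_cycleKron hn a hb c
  refine ⟨_, hS, hasSAP_cycleKron a hb c hS hn, le_antisymm ?_ ?_⟩
  · exact ((isZeroForcingSet_two_columns hn).card_sub_rank_le hS).trans (ncard_two_columns hn).le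
  · rw [card_sub_rank_eq_finrank_ker]
    have hev' : ∀ k : Fin 3, (tridiag a b c).mulVec (u k) =
        (-2 * Real.cos (2 * Real.pi * ((k + 1 : ℕ) : ℝ) / n)) • u k := by
      intro k
      rw [hev]
      fin_cases k <;> rfl
    have h := LinearMap.finrank_le_finrank_of_injective
      (f := (waveVec n u).codRestrict (LinearMap.ker (cycleKron n (tridiag a b c)).mulVecLin)
        fun w => by simpa using cycleKron_mulVec_waveVec hev' w)
      (fun w w' h => waveVec_injective hn hu (congrArg Subtype.val h))
    simpa using h

end CyclePath

theorem stmt8 (n : ℕ) (hn : 8 ≤ n) :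
    haveI : NeZero n := ⟨by omega⟩
    xi ((circG n {1}).boxProd (SimpleGraph.pathGraph 3)) = 6 ∧
    maxNullity ℝ ((circG n {1}).boxProd (SimpleGraph.pathGraph 3)) = 6 ∧
    zfn ((circG n {1}).boxProd (SimpleGraph.pathGraph 3)) = 6 := by
  have : NeZero n := ⟨by omega⟩
  obtain ⟨A, hS, hSAP, hA⟩ := exists_smat_hasSAP_nullity_six hn
  have hZ := isZeroForcingSet_two_columns hn
  have hcard := ncard_two_columns hn
  refine ⟨?_, ?_, ?_⟩
  · refine IsGreatest.csSup_eq ⟨⟨A, hS, hSAP, hA⟩, ?_⟩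
    rintro m ⟨A', hS', -, rfl⟩
    exact (hZ.card_sub_rank_le hS').trans hcard.le
  · refine IsGreatest.csSup_eq ⟨⟨A, hS, hA⟩, ?_⟩
    rintro m ⟨A', hS', rfl⟩
    exact (hZ.card_sub_rank_le hS').trans hcard.le
  · refine IsLeast.csInf_eq ⟨⟨_, hcard, hZ⟩, ?_⟩
    rintro m ⟨Z', rfl, hZ'⟩
    exact hA ▸ hZ'.card_sub_rank_le hS

end Paper
end
end
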